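/- Assume Θ₁ is negative semidefinite and Θ₂ ≤ 0. Then for every X ∈ ℝ^d and every real sequence (w_n)_{n≥N+1} with ∑_{n≥N+1} λ_n² w_n² < ∞, setting u = EX, v = K̃X and ζ = ∑_{n≥N+1} x_n w_n (this series converges absolutely, as do all series below), one has Xᵀ(FᵀP + PF + 2δP)X + 2(XᵀPℒ)ζ + 2γ ∑_{n≥N+1} λ_n(−λ_n + q_c + δ) w_n² + 2γ ∑_{n≥N+1} λ_n (a_n u + b_n v) w_n ≤ 0. (Key dissipation inequality in the proof of Theorem 2.) -/

import Mathlib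

open Matrix

/-- Negative semidefiniteness of a real matrix. -/
def Matrix.NegSemidef {ι : Type*} [Fintype ι] (M : Matrix ι ι ℝ) : Prop :=
  (-M).PosSemidef

lemma aux_quad {d : ℕ} (Q G : Matrix (Fin d) (Fin d) ℝ) (PL : Matrix (Fin d) (Fin 1) ℝ)
    (LP : Matrix (Fin 1) (Fin d) ℝ) (β : ℝ) (hT : LP = PLᵀ)
    (h : (Matrix.fromBlocks (Q + G) PL LP
      ((-β) • (1 : Matrix (Fin 1) (Fin 1) ℝ))).NegSemidef)
    (X : Fin d → ℝ) (z : ℝ) :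
    X ⬝ᵥ Q.mulVec X + X ⬝ᵥ G.mulVec X + 2 * (X ⬝ᵥ fun i => PL i 0) * z - β * z ^ 2 ≤ 0 := by
  subst hT
  have h1 := Matrix.PosSemidef.dotProduct_mulVec_nonneg h (Sum.elim X (fun _ => z))
  have e1 : X ⬝ᵥ PL.mulVec (fun _ => z) = (X ⬝ᵥ fun i => PL i 0) * z := by
    simp [dotProduct, Matrix.mulVec, Finset.sum_mul, mul_assoc]
  have e2 : (PLᵀ.mulVec X) 0 = X ⬝ᵥ fun i => PL i 0 := by
    simp [dotProduct, Matrix.mulVec, mul_comm]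
  have e3 : (fun _ : Fin 1 => z) ⬝ᵥ PLᵀ.mulVec X = z * (X ⬝ᵥ fun i => PL i 0) := by
    rw [← e2]; simp [dotProduct]
  have e4 : (fun _ : Fin 1 => z) ⬝ᵥ ((-β) • (1 : Matrix (Fin 1) (Fin 1) ℝ)).mulVec (fun _ => z)
      = - β * z ^ 2 := by
    rw [Matrix.smul_mulVec, Matrix.one_mulVec]
    simp [dotProduct]; ring
  rw [Matrix.neg_mulVec, dotProduct_neg, star_trivial, Matrix.fromBlocks_mulVec,
    Sum.elim_comp_inl, Sum.elim_comp_inr, sumElim_dotProduct_sumElim,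
    dotProduct_add, dotProduct_add, Matrix.add_mulVec, dotProduct_add, e1, e3, e4] at h1
  linarith

lemma aux_gram {d : ℕ} (E : Matrix (Fin 1) (Fin d) ℝ) (X : Fin d → ℝ) :
    X ⬝ᵥ (Eᵀ * E).mulVec X = (E.mulVec X 0) ^ 2 := by
  rw [← Matrix.mulVec_mulVec, Matrix.dotProduct_mulVec, Matrix.vecMul_transpose]
  simp [dotProduct, sq]

lemma aux_series (qd α β γ l0 u v A B : ℝ) (hα : 1 < α) (hβ : 0 < β) (hγ : 0 < γ)
    (l a b x w : ℕ → ℝ) (hl : ∀ n, l0 ≤ l n) (hl0 : 0 < l0)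
    (ha : Summable fun n => a n ^ 2) (haA : (∑' n, a n ^ 2) ≤ A ^ 2)
    (hb : Summable fun n => b n ^ 2) (hbB : (∑' n, b n ^ 2) ≤ B ^ 2)
    (hx : Summable fun n => x n ^ 2 / l n)
    (h2 : 2 * γ * (-(1 - 1 / α) * l0 + qd) + β * (∑' n, x n ^ 2 / l n) ≤ 0)
    (hw : Summable fun n => l n ^ 2 * w n ^ 2) :
    Summable (fun n => x n * w n) ∧
    Summable (fun n => l n * (-l n + qd) * w n ^ 2) ∧
    Summable (fun n => l n * (a n * u + b n * v) * w n) ∧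
    β * (∑' n, x n * w n) ^ 2 + 2 * γ * (∑' n, l n * (-l n + qd) * w n ^ 2)
      + 2 * γ * (∑' n, l n * (a n * u + b n * v) * w n)
      ≤ α * γ * (A ^ 2 * u ^ 2 + B ^ 2 * v ^ 2) := by
  have lp : ∀ n, 0 < l n := fun n => hl0.trans_le (hl n)
  have hα0 : 0 < α := by linarith
  have hS : Summable fun n => l n * w n ^ 2 := by
    refine Summable.of_nonneg_of_le (fun n => by have := lp n; positivity) (fun n => ?_)
      (hw.mul_left l0⁻¹)
    rw [← div_eq_inv_mul, le_div_iff₀ hl0]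
    have := mul_le_mul_of_nonneg_left (hl n) (mul_nonneg (lp n).le (sq_nonneg (w n)))
    nlinarith
  have young : ∀ n t, 2 * t * (x n * w n) ≤ t ^ 2 * (x n ^ 2 / l n) + l n * w n ^ 2 := by
    intro n t
    have hn := lp n
    have : t ^ 2 * (x n ^ 2 / l n) + l n * w n ^ 2 - 2 * t * (x n * w n)
      = (t * x n - l n * w n) ^ 2 / l n := by field_simp; ring
    have : 0 ≤ (t * x n - l n * w n) ^ 2 / l n := by positivity
    linarith
  have s1 : Summable (fun n => x n * w n) := by
    refine Summable.of_norm_bounded (hx.add hS) (fun n => ?_)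
    rw [Real.norm_eq_abs, abs_le]
    have y1 := young n 1
    have y2 := young n (-1)
    have p1 : 0 ≤ x n ^ 2 / l n := by have := lp n; positivity
    have p2 : 0 ≤ l n * w n ^ 2 := by have := lp n; positivity
    constructor <;> linarith
  have s2 : Summable (fun n => l n * (-l n + qd) * w n ^ 2) := by
    refine (hw.neg.add (hS.mul_left qd)).congr (fun n => ?_)
    ring
  have sab : ∀ c : ℕ → ℝ, Summable (fun n => c n ^ 2) → Summable (fun n => c n * (l n * w n)) := by
    intro c hc
    refine Summable.of_norm_bounded (hc.add hw) (fun n => ?_)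
    rw [Real.norm_eq_abs, abs_le]
    constructor <;>
      nlinarith [sq_nonneg (c n + l n * w n), sq_nonneg (c n - l n * w n), sq_nonneg (c n),
        sq_nonneg (l n * w n)]
  have s3 : Summable (fun n => l n * (a n * u + b n * v) * w n) := by
    refine (((sab a ha).mul_left u).add ((sab b hb).mul_left v)).congr (fun n => ?_)
    ring
  refine ⟨s1, s2, s3, ?_⟩
  have cs : (∑' n, x n * w n) ^ 2 ≤ (∑' n, x n ^ 2 / l n) * (∑' n, l n * w n ^ 2) := by
    have hd := discrim_le_zero (a := ∑' n, x n ^ 2 / l n) (b := -2 * ∑' n, x n * w n)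
      (c := ∑' n, l n * w n ^ 2) (fun t => by
        have := ((s1.mul_left (2 * t)).tsum_le_tsum (fun n => young n t)
          ((hx.mul_left (t ^ 2)).add hS))
        rw [(hx.mul_left (t ^ 2)).tsum_add hS, tsum_mul_left, tsum_mul_left] at this
        linarith)
    rw [discrim] at hd
    linarith
  set M := ∑' n, x n ^ 2 / l n with hM
  have key : ∀ n, β * M * (l n * w n ^ 2) + 2 * γ * (l n * (-l n + qd) * w n ^ 2)
      + 2 * γ * (l n * (a n * u + b n * v) * w n)
      ≤ α * γ * u ^ 2 * a n ^ 2 + α * γ * v ^ 2 * b n ^ 2 := by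
    intro n
    have yy : ∀ c : ℝ, 2 * γ * (c * (l n * w n)) ≤ α * γ * c ^ 2
        + γ / α * (l n * w n) ^ 2 := by
      intro c
      have : α * γ * c ^ 2 + γ / α * (l n * w n) ^ 2 - 2 * γ * (c * (l n * w n))
        = γ / α * (α * c - l n * w n) ^ 2 := by field_simp; ring
      have : 0 ≤ γ / α * (α * c - l n * w n) ^ 2 := by positivity
      linarith
    have ya := yy (a n * u)
    have yb := yy (b n * v)
    have hα1 : 0 < 1 - 1 / α := by
      rw [sub_pos, div_lt_one hα0]; exact hα
    have h3 : 2 * γ * (-(1 - 1 / α) * l n + qd) + β * M ≤ 0 := by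
      have := mul_le_mul_of_nonneg_left (hl n) (mul_nonneg hγ.le hα1.le)
      nlinarith
    have h4 := mul_nonneg (neg_nonneg.2 h3) (mul_nonneg (lp n).le (sq_nonneg (w n)))
    have e : γ / α = γ * (1 / α) := by ring
    rw [e] at ya yb
    nlinarith
  have L1 := hS.mul_left (β * M)
  have L2 := s2.mul_left (2 * γ)
  have L3 := s3.mul_left (2 * γ)
  have R1 := ha.mul_left (α * γ * u ^ 2)
  have R2 := hb.mul_left (α * γ * v ^ 2)
  have T := ((L1.add L2).add L3).tsum_le_tsum key (R1.add R2)
  rw [(L1.add L2).tsum_add L3, L1.tsum_add L2, R1.tsum_add R2, tsum_mul_left, tsum_mul_left,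
    tsum_mul_left, tsum_mul_left, tsum_mul_left] at T
  have c1 := mul_le_mul_of_nonneg_left cs hβ.le
  have c2 := mul_le_mul_of_nonneg_left haA (show 0 ≤ α * γ * u ^ 2 by positivity)
  have c3 := mul_le_mul_of_nonneg_left hbB (show 0 ≤ α * γ * v ^ 2 by positivity)
  linarith

/-- Key dissipation inequality in the proof of Theorem 2 (Dirichlet
boundary measurement): if `Θ₁ ⪯ 0` and `Θ₂ ≤ 0` (with `Θ₂` built from
`M₁ = ∑_{n≥N+1} x_n²/λ_n`), then for every `X ∈ ℝ^d` and every
square-summable-against-`λ²` tail sequence `(w_n)_{n ≥ N+1}`, with `u = EX`,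
`v = K̃X`, `ζ = ∑_{n≥N+1} x_n w_n`, one has
`Xᵀ(FᵀP + PF + 2δP)X + 2(XᵀPℒ)ζ + 2γ ∑ λ_n(-λ_n+q_c+δ)w_n² + 2γ ∑ λ_n(a_n u + b_n v)w_n ≤ 0`,
all series converging absolutely. -/
theorem dissipation_inequality_dirichlet_measurement
    (N d : ℕ) (hd : 1 ≤ d)
    (δ qc α β γ : ℝ) (hδ : 0 < δ) (hα : 1 < α) (hβ : 0 < β) (hγ : 0 < γ)
    (F P : Matrix (Fin d) (Fin d) ℝ) (hP : P.IsSymm)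
    (Lc : Matrix (Fin d) (Fin 1) ℝ)
    (E Kt : Matrix (Fin 1) (Fin d) ℝ)
    (A B : ℝ) (hA : 0 ≤ A) (hB : 0 ≤ B)
    (lam a b x : ℕ → ℝ)
    (hlam : ∀ n, N + 1 ≤ n → lam (N + 1) ≤ lam n) (hlampos : 0 < lam (N + 1))
    (ha : Summable fun n : ℕ => a (N + 1 + n) ^ 2)
    (haA : (∑' n : ℕ, a (N + 1 + n) ^ 2) ≤ A ^ 2)
    (hb : Summable fun n : ℕ => b (N + 1 + n) ^ 2)
    (hbB : (∑' n : ℕ, b (N + 1 + n) ^ 2) ≤ B ^ 2)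
    (hx : Summable fun n : ℕ => x (N + 1 + n) ^ 2 / lam (N + 1 + n))
    (hΘ₁ : (Matrix.fromBlocks
        (Fᵀ * P + P * F + (2 * δ) • P +
          (α * γ) • (A ^ 2 • (Eᵀ * E) + B ^ 2 • (Ktᵀ * Kt)))
        (P * Lc) (Lcᵀ * P) ((-β) • (1 : Matrix (Fin 1) (Fin 1) ℝ))).NegSemidef)
    (hΘ₂ : 2 * γ * (-(1 - 1 / α) * lam (N + 1) + qc + δ)
      + β * (∑' n : ℕ, x (N + 1 + n) ^ 2 / lam (N + 1 + n)) ≤ 0)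
    (X : Fin d → ℝ) (w : ℕ → ℝ)
    (hw : Summable fun n : ℕ => lam (N + 1 + n) ^ 2 * w (N + 1 + n) ^ 2) :
    Summable (fun n : ℕ => |x (N + 1 + n) * w (N + 1 + n)|) ∧
    Summable (fun n : ℕ =>
      |lam (N + 1 + n) * (-lam (N + 1 + n) + qc + δ) * w (N + 1 + n) ^ 2|) ∧
    Summable (fun n : ℕ =>
      |lam (N + 1 + n) * (a (N + 1 + n) * (E.mulVec X 0) + b (N + 1 + n) * (Kt.mulVec X 0))
        * w (N + 1 + n)|) ∧
    X ⬝ᵥ ((Fᵀ * P + P * F + (2 * δ) • P).mulVec X)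
      + 2 * (X ⬝ᵥ fun i => (P * Lc) i 0) * (∑' n : ℕ, x (N + 1 + n) * w (N + 1 + n))
      + 2 * γ * (∑' n : ℕ,
          lam (N + 1 + n) * (-lam (N + 1 + n) + qc + δ) * w (N + 1 + n) ^ 2)
      + 2 * γ * (∑' n : ℕ,
          lam (N + 1 + n) * (a (N + 1 + n) * (E.mulVec X 0) + b (N + 1 + n) * (Kt.mulVec X 0))
            * w (N + 1 + n)) ≤ 0 := by
  obtain ⟨s1, s2, s3, hs⟩ := aux_series (qc + δ) α β γ (lam (N + 1)) (E.mulVec X 0)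
    (Kt.mulVec X 0) A B hα hβ hγ (fun n => lam (N + 1 + n)) (fun n => a (N + 1 + n))
    (fun n => b (N + 1 + n)) (fun n => x (N + 1 + n)) (fun n => w (N + 1 + n))
    (fun n => hlam _ (by omega)) hlampos ha haA hb hbB hx (by rw [← add_assoc]; exact hΘ₂) hw
  simp only [← add_assoc (-lam _) qc δ] at s2 hs
  refine ⟨s1.abs, s2.abs, s3.abs, ?_⟩
  have hq := aux_quad _ _ _ _ β (by rw [Matrix.transpose_mul, hP.eq]) hΘ₁ X
    (∑' n : ℕ, x (N + 1 + n) * w (N + 1 + n))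
  have hg : X ⬝ᵥ ((α * γ) • (A ^ 2 • (Eᵀ * E) + B ^ 2 • (Ktᵀ * Kt))).mulVec X
      = α * γ * (A ^ 2 * (E.mulVec X 0) ^ 2 + B ^ 2 * (Kt.mulVec X 0) ^ 2) := by
    rw [Matrix.smul_mulVec, Matrix.add_mulVec, Matrix.smul_mulVec, Matrix.smul_mulVec,
      dotProduct_smul, dotProduct_add, dotProduct_smul, dotProduct_smul, aux_gram, aux_gram]
    simp only [smul_eq_mul]
  rw [hg] at hq
  linarith
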